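/- arXiv:cond-mat/0703319 — 2 statements merged into one kernel-verified Lean document; each statement's English description precedes it below -/
import Mathlib

section
/- Let L ≥ 1, η, κ ∈ ℂ, and λ, μ ∈ ℂ with sinh(λ+η) ≠ 0, sinh(μ+η) ≠ 0 and sinh(λ−μ+η) ≠ 0. Then the twisted transfer matrices commute: (A(λ) + κ D(λ))(A(μ) + κ D(μ)) = (A(μ) + κ D(μ))(A(λ) + κ D(λ)) as operators on (ℂ²)^{⊗L}. -/
open Complex Matrix

/-- The six-vertex R-matrix on ℂ² ⊗ ℂ², in the basis `e₁⊗e₁, e₁⊗e₂, e₂⊗e₁, e₂⊗e₂`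
(encoded as pairs `(0,0), (0,1), (1,0), (1,1)` in `Fin 2 × Fin 2`). -/
noncomputable def Rmat (η lam : ℂ) : Matrix (Fin 2 × Fin 2) (Fin 2 × Fin 2) ℂ :=
  Matrix.of fun p q =>
    if p = q then (if p.1 = p.2 then 1 else Complex.sinh lam / Complex.sinh (lam + η))
    else if p.1 = q.2 ∧ p.2 = q.1 ∧ p.1 ≠ p.2 then Complex.sinh η / Complex.sinh (lam + η)
    else 0

/-- Basis states of the chain `(ℂ²)^{⊗L}`. -/
abbrev Chain (L : ℕ) := Fin L → Fin 2

/-- `R_{aj}(λ)`: the R-matrix acting on the auxiliary factor and the `j`-th site of the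
chain, and as the identity on all other sites. -/
noncomputable def Raux (L : ℕ) (η lam : ℂ) (j : Fin L) :
    Matrix (Fin 2 × Chain L) (Fin 2 × Chain L) ℂ :=
  Matrix.of fun p q =>
    Rmat η lam (p.1, p.2 j) (q.1, q.2 j) * (if ∀ k, k ≠ j → p.2 k = q.2 k then 1 else 0)

/-- The monodromy matrix `𝒯_a(λ) = R_{aL}(λ) ⋯ R_{a2}(λ) R_{a1}(λ)` on `ℂ²_a ⊗ (ℂ²)^{⊗L}`. -/
noncomputable def monodromy (L : ℕ) (η lam : ℂ) :
    Matrix (Fin 2 × Chain L) (Fin 2 × Chain L) ℂ :=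
  ((List.ofFn fun j : Fin L => Raux L η lam j).reverse).prod

/-- `A(λ)`, the upper-left block of the monodromy matrix w.r.t. the auxiliary space. -/
noncomputable def Aop (L : ℕ) (η lam : ℂ) : Matrix (Chain L) (Chain L) ℂ :=
  Matrix.of fun v w => monodromy L η lam (0, v) (0, w)

/-- `B(λ)`, the upper-right block of the monodromy matrix w.r.t. the auxiliary space. -/
noncomputable def Bop (L : ℕ) (η lam : ℂ) : Matrix (Chain L) (Chain L) ℂ :=
  Matrix.of fun v w => monodromy L η lam (0, v) (1, w)

/-- `C(λ)`, the lower-left block of the monodromy matrix w.r.t. the auxiliary space. -/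
noncomputable def Cop (L : ℕ) (η lam : ℂ) : Matrix (Chain L) (Chain L) ℂ :=
  Matrix.of fun v w => monodromy L η lam (1, v) (0, w)

/-- `D(λ)`, the lower-right block of the monodromy matrix w.r.t. the auxiliary space. -/
noncomputable def Dop (L : ℕ) (η lam : ℂ) : Matrix (Chain L) (Chain L) ℂ :=
  Matrix.of fun v w => monodromy L η lam (1, v) (1, w)

/-- The transfer matrix `T(λ) = Tr_a 𝒯_a(λ) = A(λ) + D(λ)` on `(ℂ²)^{⊗L}`. -/
noncomputable def transfer (L : ℕ) (η lam : ℂ) : Matrix (Chain L) (Chain L) ℂ :=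
  Matrix.of fun v w => ∑ a : Fin 2, monodromy L η lam (a, v) (a, w)

open Topology

section YangBaxterAlgebra

variable {𝒜 : Type*} [Ring 𝒜]

/-- The embedding `P ↦ P ⊗ 1` of `2 × 2` matrices over `𝒜`, acting on the first of two
auxiliary spaces. -/
def leftEmbed : Matrix (Fin 2) (Fin 2) 𝒜 →* Matrix (Fin 2 × Fin 2) (Fin 2 × Fin 2) 𝒜 where
  toFun P := Matrix.of fun p q => if p.2 = q.2 then P p.1 q.1 else 0
  map_one' := by
    ext ⟨a, b⟩ ⟨c, d⟩
    fin_cases a <;> fin_cases b <;> fin_cases c <;> fin_cases d <;> simp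
  map_mul' P Q := by
    ext ⟨a, b⟩ ⟨c, d⟩
    fin_cases b <;> fin_cases d <;>
      simp [Matrix.mul_apply, Fintype.sum_prod_type]

/-- The embedding `Q ↦ 1 ⊗ Q` of `2 × 2` matrices over `𝒜`, acting on the second of two
auxiliary spaces. -/
def rightEmbed : Matrix (Fin 2) (Fin 2) 𝒜 →* Matrix (Fin 2 × Fin 2) (Fin 2 × Fin 2) 𝒜 where
  toFun Q := Matrix.of fun p q => if p.1 = q.1 then Q p.2 q.2 else 0
  map_one' := by
    ext ⟨a, b⟩ ⟨c, d⟩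
    fin_cases a <;> fin_cases b <;> fin_cases c <;> fin_cases d <;> simp
  map_mul' P Q := by
    ext ⟨a, b⟩ ⟨c, d⟩
    fin_cases a <;> fin_cases c <;>
      simp [Matrix.mul_apply, Fintype.sum_prod_type]

theorem leftEmbed_apply (P : Matrix (Fin 2) (Fin 2) 𝒜) (p q : Fin 2 × Fin 2) :
    leftEmbed P p q = if p.2 = q.2 then P p.1 q.1 else 0 := rfl

theorem rightEmbed_apply (Q : Matrix (Fin 2) (Fin 2) 𝒜) (p q : Fin 2 × Fin 2) :
    rightEmbed Q p q = if p.1 = q.1 then Q p.2 q.2 else 0 := rfl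

theorem leftEmbed_mul_rightEmbed_apply (P Q : Matrix (Fin 2) (Fin 2) 𝒜) (a b c d : Fin 2) :
    (leftEmbed P * rightEmbed Q) (a, b) (c, d) = P a c * Q b d := by
  simp [Matrix.mul_apply, Fintype.sum_prod_type, leftEmbed_apply, rightEmbed_apply]

theorem rightEmbed_mul_leftEmbed_apply (P Q : Matrix (Fin 2) (Fin 2) 𝒜) (a b c d : Fin 2) :
    (rightEmbed Q * leftEmbed P) (a, b) (c, d) = Q b d * P a c := by
  simp [Matrix.mul_apply, Fintype.sum_prod_type, leftEmbed_apply, rightEmbed_apply]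

theorem commute_leftEmbed_rightEmbed {P Q : Matrix (Fin 2) (Fin 2) 𝒜}
    (h : ∀ a b c d, Commute (P a b) (Q c d)) : Commute (leftEmbed P) (rightEmbed Q) := by
  ext ⟨a, b⟩ ⟨c, d⟩
  rw [leftEmbed_mul_rightEmbed_apply, rightEmbed_mul_leftEmbed_apply]
  exact h _ _ _ _

/-- Exchange relations at each site, together with commutation between distinct sites, give
the exchange relation for the ordered products. -/
theorem exchange_list_prod {M ι : Type*} [Monoid M] (R : M) (p q : ι → M)
    (h : ∀ i, R * (p i * q i) = q i * p i * R) (hc : ∀ i j, i ≠ j → Commute (p i) (q j))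
    (l : List ι) (hl : l.Nodup) :
    R * ((l.map p).prod * (l.map q).prod) = (l.map q).prod * (l.map p).prod * R := by
  induction l with
  | nil => simp
  | cons i l ih =>
    obtain ⟨hi, hl⟩ := List.nodup_cons.mp hl
    have ih := ih hl
    have c₁ : Commute (l.map p).prod (q i) := by
      refine Commute.list_prod_left _ _ fun x hx => ?_
      obtain ⟨j, hj, rfl⟩ := List.mem_map.mp hx
      exact hc j i fun e => hi (e ▸ hj)
    have c₂ : Commute (p i) (l.map q).prod := by
      refine Commute.list_prod_right _ _ fun x hx => ?_
      obtain ⟨j, hj, rfl⟩ := List.mem_map.mp hx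
      exact hc i j fun e => hi (e ▸ hj)
    simp only [List.map_cons, List.prod_cons]
    generalize (l.map p).prod = P at *
    generalize (l.map q).prod = Q at *
    calc R * (p i * P * (q i * Q)) = R * (p i * (P * q i) * Q) := by simp only [mul_assoc]
      _ = R * (p i * q i) * (P * Q) := by rw [c₁.eq]; simp only [mul_assoc]
      _ = q i * p i * (R * (P * Q)) := by rw [h]; simp only [mul_assoc]
      _ = q i * (p i * Q) * P * R := by rw [ih]; simp only [mul_assoc]
      _ = q i * Q * (p i * P) * R := by rw [c₂.eq]; simp only [mul_assoc]

variable [Algebra ℂ 𝒜]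

/-- The twisted traces of two `2 × 2` operator matrices satisfying the exchange relation commute
when the R-matrix is invertible. -/
theorem twisted_trace_commute (P Q : Matrix (Fin 2) (Fin 2) 𝒜) (η u κ : ℂ)
    (hu : sinh (u + η) ≠ 0) (hu' : sinh (u - η) ≠ 0)
    (h : (Rmat η u).map (algebraMap ℂ 𝒜) * (leftEmbed P * rightEmbed Q) =
      rightEmbed Q * leftEmbed P * (Rmat η u).map (algebraMap ℂ 𝒜)) :
    Commute (P 0 0 + κ • P 1 1) (Q 0 0 + κ • Q 1 1) := by
  have e (a b c d : Fin 2) := congrFun (congrFun h (a, b)) (c, d)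
  simp only [Matrix.mul_apply (N := leftEmbed P * rightEmbed Q),
    Matrix.mul_apply (M := rightEmbed Q * leftEmbed P), Fintype.sum_prod_type,
    leftEmbed_mul_rightEmbed_apply, rightEmbed_mul_leftEmbed_apply, Fin.sum_univ_two,
    Matrix.map_apply, ← Algebra.commutes, ← Algebra.smul_def] at e
  have e0 := e 0 0 0 0
  have e1 := e 1 1 1 1
  have e2 := e 0 1 0 1
  have e3 := e 1 0 1 0
  have e4 := e 0 1 1 0
  have e5 := e 1 0 0 1
  have hc : (sinh u / sinh (u + η)) ^ 2 - (sinh η / sinh (u + η)) ^ 2 ≠ 0 := by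
    have : (sinh u / sinh (u + η)) ^ 2 - (sinh η / sinh (u + η)) ^ 2 =
        sinh (u - η) / sinh (u + η) := by
      field_simp
      rw [sinh_add, sinh_sub]
      linear_combination - sinh u ^ 2 * cosh_sq η + sinh η ^ 2 * cosh_sq u
    rw [this]
    exact div_ne_zero hu' hu
  simp only [Rmat, Matrix.of_apply, Prod.mk.injEq, zero_ne_one, one_ne_zero, and_true,
    and_false, and_self, ne_eq, not_true_eq_false, not_false_eq_true, if_true, if_false,
    zero_smul, one_smul, add_zero, zero_add] at e0 e1 e2 e3 e4 e5
  generalize sinh u / sinh (u + η) = b at *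
  generalize sinh η / sinh (u + η) = c at *
  have hS : (b ^ 2 - c ^ 2) • (P 0 0 * Q 1 1 - Q 1 1 * P 0 0 + P 1 1 * Q 0 0 - Q 0 0 * P 1 1) =
      (0 : 𝒜) := by
    linear_combination (norm := module) b • e2 + b • e3 - c • e4 - c • e5
  have hS := (smul_eq_zero.mp hS).resolve_left hc
  simp only [Commute, SemiconjBy, add_mul, mul_add, smul_mul_assoc, mul_smul_comm]
  linear_combination (norm := module) e0 + κ ^ 2 • e1 + κ • hS

end YangBaxterAlgebra

section Site

variable {L : ℕ}

theorem sum_agree_off (j : Fin L) (v : Chain L) (f : Chain L → ℂ) :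
    ∑ w, f w * (if ∀ k, k ≠ j → v k = w k then 1 else 0) =
      ∑ t, f (Function.update v j t) := by
  simp only [mul_ite, mul_one, mul_zero, ← Finset.sum_filter]
  symm
  refine Finset.sum_bij' (fun t _ => Function.update v j t) (fun w _ => w j) ?_ ?_ ?_ ?_ ?_
  · intro t _
    simp +contextual [Function.update_of_ne]
  · simp
  · simp
  · intro w hw
    ext k
    by_cases hk : k = j
    · subst hk; simp
    · simp [hk, (Finset.mem_filter.mp hw).2 k hk]
  · simp

/-- The operator on the chain acting by a given `2 × 2` matrix on the site `j`. -/
def siteEmbed (j : Fin L) : Matrix (Fin 2) (Fin 2) ℂ →ₐ[ℂ] Matrix (Chain L) (Chain L) ℂ :=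
  AlgHom.ofLinearMap
    { toFun := fun M => Matrix.of fun v w =>
        M (v j) (w j) * (if ∀ k, k ≠ j → v k = w k then 1 else 0)
      map_add' := fun M N => by ext; exact add_mul _ _ _
      map_smul' := fun c M => by ext; exact mul_assoc _ _ _ }
    (by
      ext v w
      simp only [LinearMap.coe_mk, AddHom.coe_mk, Matrix.of_apply, Matrix.one_apply, ← ite_and,
        mul_ite, mul_one, mul_zero]
      refine if_congr ⟨fun h => funext fun k => ?_, ?_⟩ rfl rfl
      · by_cases hk : k = j
        · exact hk ▸ h.2
        · exact h.1 k hk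
      · rintro rfl; simp)
    (fun M N => by
      ext v x
      have key := sum_agree_off j v fun w => M (v j) (w j) *
        (N (w j) (x j) * if ∀ k, k ≠ j → w k = x k then 1 else 0)
      simp only [LinearMap.coe_mk, AddHom.coe_mk, Matrix.of_apply, Matrix.mul_apply]
      refine Eq.trans ?_ (Eq.trans key.symm ?_)
      · rw [Finset.sum_mul]
        refine Finset.sum_congr rfl fun t _ => ?_
        have : (∀ k, k ≠ j → Function.update v j t k = x k) ↔ ∀ k, k ≠ j → v k = x k :=
          forall₂_congr fun k hk => by rw [Function.update_of_ne hk]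
        simp only [this, Function.update_self]
        ring
      · exact Finset.sum_congr rfl fun w _ => by ring)

theorem siteEmbed_apply (j : Fin L) (M : Matrix (Fin 2) (Fin 2) ℂ) (v w : Chain L) :
    siteEmbed j M v w = M (v j) (w j) * (if ∀ k, k ≠ j → v k = w k then 1 else 0) := rfl

theorem siteEmbed_mul_apply_of_ne {i j : Fin L} (hij : i ≠ j) (M N : Matrix (Fin 2) (Fin 2) ℂ)
    (v x : Chain L) :
    (siteEmbed i M * siteEmbed j N) v x = M (v i) (x i) * N (v j) (x j) *
      (if ∀ k, k ≠ i → k ≠ j → v k = x k then 1 else 0) := by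
  have key := sum_agree_off i v fun w => M (v i) (w i) *
    (N (w j) (x j) * if ∀ k, k ≠ j → w k = x k then 1 else 0)
  have h (t : Fin 2) : (∀ k, k ≠ j → Function.update v i t k = x k) ↔
      t = x i ∧ ∀ k, k ≠ i → k ≠ j → v k = x k := by
    constructor
    · intro h
      refine ⟨by simpa using h i hij, fun k hk hk' => ?_⟩
      simpa [hk] using h k hk'
    · rintro ⟨rfl, h⟩ k hk
      by_cases hk' : k = i
      · subst hk'; simp
      · simpa [hk'] using h k hk' hk
  simp only [Matrix.mul_apply, siteEmbed_apply]
  calc _ = _ := Finset.sum_congr rfl fun w _ => by ring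
    _ = _ := key
    _ = _ := by
      simp only [h, Function.update_self, Function.update_of_ne hij.symm, ite_and]
      simp

theorem commute_siteEmbed {i j : Fin L} (hij : i ≠ j) (M N : Matrix (Fin 2) (Fin 2) ℂ) :
    Commute (siteEmbed i M) (siteEmbed j N) := by
  ext v x
  rw [siteEmbed_mul_apply_of_ne hij, siteEmbed_mul_apply_of_ne hij.symm, mul_comm (M _ _)]
  congr 2
  exact propext (forall_congr' fun k => forall_comm)

end Site

/-- The R-matrix as a `2 × 2` matrix with respect to its first tensor factor. -/
noncomputable def Rblock (η lam : ℂ) : Matrix (Fin 2) (Fin 2) (Matrix (Fin 2) (Fin 2) ℂ) :=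
  Matrix.of fun a b => Matrix.of fun s t => Rmat η lam (a, s) (b, t)

/-- The Yang–Baxter equation for the six-vertex R-matrix. -/
theorem yang_baxter (η lam mu : ℂ) (h1 : sinh (lam + η) ≠ 0) (h2 : sinh (mu + η) ≠ 0)
    (h3 : sinh (lam - mu + η) ≠ 0) :
    (Rmat η (lam - mu)).map (algebraMap ℂ (Matrix (Fin 2) (Fin 2) ℂ)) *
        (leftEmbed (Rblock η lam) * rightEmbed (Rblock η mu)) =
      rightEmbed (Rblock η mu) * leftEmbed (Rblock η lam) *
        (Rmat η (lam - mu)).map (algebraMap ℂ (Matrix (Fin 2) (Fin 2) ℂ)) := by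
  have i₁ : sinh lam * sinh (lam - mu + η) =
      sinh (lam - mu) * sinh (lam + η) + sinh mu * sinh η := by
    simp only [sinh, exp_add, exp_sub, exp_neg]
    field_simp
    ring
  have i₂ : sinh (lam - mu + η) * sinh (mu + η) =
      sinh η * sinh (lam + η) + sinh (lam - mu) * sinh mu := by
    simp only [sinh, exp_add, exp_sub, exp_neg]
    field_simp
    ring
  have i₃ : sinh lam * sinh (mu + η) = sinh mu * sinh (lam + η) + sinh (lam - mu) * sinh η := by
    simp only [sinh, exp_add, exp_sub, exp_neg]
    field_simp
    ring
  have j₁ : sinh lam / sinh (lam + η) * (sinh η / sinh (mu + η)) =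
      sinh (lam - mu) / sinh (lam - mu + η) * (sinh η / sinh (mu + η)) +
        sinh η / sinh (lam - mu + η) * (sinh mu / sinh (mu + η)) * (sinh η / sinh (lam + η)) := by
    field_simp
    linear_combination sinh η * i₁
  have j₂ : sinh η / sinh (lam + η) =
      sinh η / sinh (lam - mu + η) * (sinh η / sinh (mu + η)) +
        sinh (lam - mu) / sinh (lam - mu + η) * (sinh mu / sinh (mu + η)) *
          (sinh η / sinh (lam + η)) := by
    field_simp
    linear_combination sinh η * i₂
  have j₃ : sinh η / sinh (lam - mu + η) * (sinh lam / sinh (lam + η)) =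
      sinh η / sinh (lam - mu + η) * (sinh mu / sinh (mu + η)) +
        sinh (lam - mu) / sinh (lam - mu + η) * (sinh η / sinh (lam + η)) *
          (sinh η / sinh (mu + η)) := by
    field_simp
    linear_combination sinh η * i₃
  clear i₁ i₂ i₃ h1 h2 h3
  ext ⟨a, b⟩ ⟨c, d⟩ s t
  simp only [Matrix.mul_apply (N := leftEmbed _ * rightEmbed _),
    Matrix.mul_apply (M := rightEmbed _ * leftEmbed _), Fintype.sum_prod_type,
    leftEmbed_mul_rightEmbed_apply, rightEmbed_mul_leftEmbed_apply, Fin.sum_univ_two,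
    Matrix.map_apply, ← Algebra.commutes, ← Algebra.smul_def, Matrix.add_apply, Matrix.smul_apply,
    Matrix.mul_apply (n := Fin 2)]
  simp only [Rmat, Rblock, Matrix.of_apply, smul_eq_mul]
  generalize sinh (lam - mu) / sinh (lam - mu + η) = b₁ at *
  generalize sinh η / sinh (lam - mu + η) = c₁ at *
  generalize sinh lam / sinh (lam + η) = b₂ at *
  generalize sinh η / sinh (lam + η) = c₂ at *
  generalize sinh mu / sinh (mu + η) = b₃ at *
  generalize sinh η / sinh (mu + η) = c₃ at *
  revert a b c d s t
  simp [Fin.forall_fin_two]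
  grind

theorem leftEmbed_map {𝒜 ℬ : Type*} [Ring 𝒜] [Ring ℬ] (f : 𝒜 →+* ℬ)
    (P : Matrix (Fin 2) (Fin 2) 𝒜) :
    leftEmbed (f.mapMatrix P) = f.mapMatrix (leftEmbed P) := by
  ext p q
  simp only [leftEmbed_apply, RingHom.mapMatrix_apply, Matrix.map_apply, apply_ite f, map_zero]

theorem rightEmbed_map {𝒜 ℬ : Type*} [Ring 𝒜] [Ring ℬ] (f : 𝒜 →+* ℬ)
    (P : Matrix (Fin 2) (Fin 2) 𝒜) :
    rightEmbed (f.mapMatrix P) = f.mapMatrix (rightEmbed P) := by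
  ext p q
  simp only [rightEmbed_apply, RingHom.mapMatrix_apply, Matrix.map_apply, apply_ite f, map_zero]

section Monodromy

variable {L : ℕ}

/-- The operator `R_{aj}(λ)` as a `2 × 2` matrix of operators on the chain. -/
noncomputable def siteBlock (η lam : ℂ) (j : Fin L) :
    Matrix (Fin 2) (Fin 2) (Matrix (Chain L) (Chain L) ℂ) :=
  (siteEmbed j : _ →+* Matrix (Chain L) (Chain L) ℂ).mapMatrix (Rblock η lam)

/-- The monodromy matrix as a `2 × 2` matrix of operators on the chain. -/
noncomputable def monodromyBlock (L : ℕ) (η lam : ℂ) :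
    Matrix (Fin 2) (Fin 2) (Matrix (Chain L) (Chain L) ℂ) :=
  ((List.finRange L).reverse.map (siteBlock η lam)).prod

theorem monodromyBlock_apply (η lam : ℂ) (a b : Fin 2) (v w : Chain L) :
    monodromyBlock L η lam a b v w = monodromy L η lam (a, v) (b, w) := by
  have h : monodromy L η lam =
      Matrix.compRingEquiv (Fin 2) (Chain L) ℂ (monodromyBlock L η lam) := by
    rw [monodromyBlock, map_list_prod, List.map_map, monodromy, List.ofFn_eq_map,
      ← List.map_reverse]
    rfl
  rw [h]
  rfl

theorem siteBlock_exchange (η lam mu : ℂ) (h1 : sinh (lam + η) ≠ 0) (h2 : sinh (mu + η) ≠ 0)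
    (h3 : sinh (lam - mu + η) ≠ 0) (j : Fin L) :
    (Rmat η (lam - mu)).map (algebraMap ℂ (Matrix (Chain L) (Chain L) ℂ)) *
        (leftEmbed (siteBlock η lam j) * rightEmbed (siteBlock η mu j)) =
      rightEmbed (siteBlock η mu j) * leftEmbed (siteBlock η lam j) *
        (Rmat η (lam - mu)).map (algebraMap ℂ (Matrix (Chain L) (Chain L) ℂ)) := by
  have h := congrArg (siteEmbed j : _ →+* Matrix (Chain L) (Chain L) ℂ).mapMatrix
    (yang_baxter η lam mu h1 h2 h3)
  have hR : (siteEmbed j : _ →+* Matrix (Chain L) (Chain L) ℂ).mapMatrix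
      ((Rmat η (lam - mu)).map (algebraMap ℂ (Matrix (Fin 2) (Fin 2) ℂ))) =
      (Rmat η (lam - mu)).map (algebraMap ℂ (Matrix (Chain L) (Chain L) ℂ)) := by
    ext1 p q
    exact (siteEmbed j).commutes _
  simpa only [siteBlock, map_mul, hR, ← leftEmbed_map, ← rightEmbed_map] using h

theorem monodromyBlock_exchange (η lam mu : ℂ) (h1 : sinh (lam + η) ≠ 0)
    (h2 : sinh (mu + η) ≠ 0) (h3 : sinh (lam - mu + η) ≠ 0) :
    (Rmat η (lam - mu)).map (algebraMap ℂ (Matrix (Chain L) (Chain L) ℂ)) *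
        (leftEmbed (monodromyBlock L η lam) * rightEmbed (monodromyBlock L η mu)) =
      rightEmbed (monodromyBlock L η mu) * leftEmbed (monodromyBlock L η lam) *
        (Rmat η (lam - mu)).map (algebraMap ℂ (Matrix (Chain L) (Chain L) ℂ)) := by
  have h := exchange_list_prod _ _ _ (siteBlock_exchange (L := L) η lam mu h1 h2 h3)
    (fun i j hij => commute_leftEmbed_rightEmbed fun a b c d => commute_siteEmbed hij _ _)
    (List.finRange L).reverse (List.nodup_reverse.mpr (List.nodup_finRange L))
  simpa only [monodromyBlock, map_list_prod, List.map_map, Function.comp_def] using h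

theorem twisted_transfer_eq (η κ lam : ℂ) :
    Aop L η lam + κ • Dop L η lam =
      monodromyBlock L η lam 0 0 + κ • monodromyBlock L η lam 1 1 := by
  ext v w
  simp [Aop, Dop, monodromyBlock_apply]

theorem continuousAt_monodromy (η lam : ℂ) (h : sinh (lam + η) ≠ 0) :
    ContinuousAt (monodromy L η) lam := by
  have hR (p q : Fin 2 × Fin 2) : ContinuousAt (fun x => Rmat η x p q) lam := by
    simp only [Rmat, Matrix.of_apply]
    split_ifs <;> fun_prop (disch := assumption)
  have hRaux (j : Fin L) : ContinuousAt (fun x => Raux L η x j) lam := by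
    refine continuousAt_pi.mpr fun p => continuousAt_pi.mpr fun q => ?_
    exact (hR _ _).mul continuousAt_const
  unfold monodromy
  simp only [List.ofFn_eq_map, ← List.map_reverse]
  exact tendsto_list_prod _ fun j _ => hRaux j

theorem continuousAt_twisted_transfer (η κ lam : ℂ) (h : sinh (lam + η) ≠ 0) :
    ContinuousAt (fun x => Aop L η x + κ • Dop L η x) lam := by
  have hT := continuousAt_monodromy (L := L) η lam h
  have hT' (p q) : ContinuousAt (fun x => monodromy L η x p q) lam :=
    continuousAt_pi.mp (continuousAt_pi.mp hT p) q
  refine continuousAt_pi.mpr fun v => continuousAt_pi.mpr fun w => ?_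
  exact (hT' _ _).add (continuousAt_const.mul (hT' _ _))

end Monodromy

/-- The twisted transfer matrices `A(λ) + κ D(λ)` commute for different spectral
parameters. -/
theorem twisted_transfer_commute (L : ℕ) (hL : 1 ≤ L) (η κ lam mu : ℂ)
    (h1 : Complex.sinh (lam + η) ≠ 0) (h2 : Complex.sinh (mu + η) ≠ 0)
    (h3 : Complex.sinh (lam - mu + η) ≠ 0) :
    (Aop L η lam + κ • Dop L η lam) * (Aop L η mu + κ • Dop L η mu) =
      (Aop L η mu + κ • Dop L η mu) * (Aop L η lam + κ • Dop L η lam) := by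
  have hsinh (s : ℂ) : ∀ᶠ x in 𝓝[≠] lam, sinh (x - s) ≠ 0 := by
    by_cases h : sinh (lam - s) = 0
    · have hd : HasDerivAt (fun x => sinh (x - s)) (cosh (lam - s) * 1) lam :=
        ((hasDerivAt_id lam).sub_const s).csinh
      refine hd.eventually_ne ?_
      intro h0
      have := cosh_sq (lam - s)
      simp_all
    · exact ((by fun_prop : ContinuousAt (fun x => sinh (x - s)) lam).eventually_ne
        h).filter_mono nhdsWithin_le_nhds
  have hcomm : ∀ᶠ x in 𝓝[≠] lam,
      (Aop L η x + κ • Dop L η x) * (Aop L η mu + κ • Dop L η mu) =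
        (Aop L η mu + κ • Dop L η mu) * (Aop L η x + κ • Dop L η x) := by
    filter_upwards [hsinh (-η), hsinh (mu - η), hsinh (mu + η)] with x k1 k2 k3
    rw [sub_neg_eq_add] at k1
    rw [← sub_add] at k2
    rw [← sub_sub] at k3
    simp only [twisted_transfer_eq]
    exact twisted_trace_commute _ _ η (x - mu) κ k2 k3 (monodromyBlock_exchange η x mu k1 h2 k2)
  have hcont := continuousAt_twisted_transfer (L := L) η κ lam h1
  have hl := (hcont.mul (continuousAt_const (y := Aop L η mu + κ • Dop L η mu))).tendsto.mono_left
    (nhdsWithin_le_nhds (s := {lam}ᶜ))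
  have hr := ((continuousAt_const (y := Aop L η mu + κ • Dop L η mu)).mul hcont).tendsto.mono_left
    (nhdsWithin_le_nhds (s := {lam}ᶜ))
  exact tendsto_nhds_unique (hl.congr' hcomm) hr
end

section
/- Let L ≥ 2, J ∈ ℝ with J ≠ 0, and η ∈ ℂ with sinh η ≠ 0; set Δ = cosh η. Then the map λ ↦ T(λ) is differentiable at λ = 0 and the XXZ Hamiltonian is recovered as the logarithmic derivative of the transfer matrix: H₀ = 2 J sinh(η) · T(0)⁻¹ · T′(0). -/
open Complex Matrix

/-- The Pauli matrices `σ^x, σ^y, σ^z` (indexed by `0, 1, 2` ↔ `x, y, z`). -/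
noncomputable def pauli : Fin 3 → Matrix (Fin 2) (Fin 2) ℂ :=
  ![!![0, 1; 1, 0], !![0, -Complex.I; Complex.I, 0], !![1, 0; 0, -1]]

/-- `σ_j`: the one-site operator `m` acting on the `j`-th tensor factor of `(ℂ²)^{⊗L}`
and as the identity on all other factors. -/
noncomputable def siteOp (L : ℕ) (m : Matrix (Fin 2) (Fin 2) ℂ) (j : Fin L) :
    Matrix (Chain L) (Chain L) ℂ :=
  Matrix.of fun v w => m (v j) (w j) * (if ∀ k, k ≠ j → v k = w k then 1 else 0)

/-- The spin-1/2 XXZ Hamiltonian with periodic boundary conditions: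
`H₀ = J Σ_j [σ_j^x σ_{j+1}^x + σ_j^y σ_{j+1}^y + Δ(σ_j^z σ_{j+1}^z − 1)]`,
with site indices modulo `L`. -/
noncomputable def XXZham (L : ℕ) [NeZero L] (J : ℝ) (Δ : ℂ) :
    Matrix (Chain L) (Chain L) ℂ :=
  (J : ℂ) • ∑ j : Fin L,
    (siteOp L (pauli 0) j * siteOp L (pauli 0) (j + 1) +
      siteOp L (pauli 1) j * siteOp L (pauli 1) (j + 1) +
      Δ • (siteOp L (pauli 2) j * siteOp L (pauli 2) (j + 1) - 1))

/-- The total spin operator `S^z = (1/2) Σ_j σ_j^z`. -/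
noncomputable def Sz (L : ℕ) : Matrix (Chain L) (Chain L) ℂ :=
  (2 : ℂ)⁻¹ • ∑ j : Fin L, siteOp L (pauli 2) j
open Finset in
theorem List.reverse_ofFn_prod_apply {ι R : Type*} [Fintype ι] [DecidableEq ι] [CommSemiring R]
    {n : ℕ} (K : Fin n → Matrix ι ι R) (a b : ι) :
    (List.ofFn K).reverse.prod a b =
      ∑ s : Fin n → ι, if (Fin.snoc s a : Fin (n + 1) → ι) 0 = b then
        ∏ j, K j ((Fin.snoc s a : Fin (n + 1) → ι) j.succ) (s j) else 0 := by
  induction n generalizing b with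
  | zero => simp [Matrix.one_apply, Fin.snoc]
  | succ n ih =>
    have hcons : ∀ (c : ι) (t : Fin n → ι),
        (Fin.snoc (Fin.cons c t : Fin (n + 1) → ι) a : Fin (n + 2) → ι) =
          Fin.cons c (Fin.snoc t a : Fin (n + 1) → ι) :=
      fun c t => (Fin.cons_snoc_eq_snoc_cons (β := ι) c t a).symm
    have hequiv : ∀ x : ι × (Fin n → ι),
        (Fin.consEquiv fun _ : Fin (n + 1) => ι) x = Fin.cons x.1 x.2 := fun _ => rfl
    rw [List.ofFn_succ, List.reverse_cons, List.prod_append, List.prod_singleton, Matrix.mul_apply,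
      ← (Fin.consEquiv fun _ : Fin (n + 1) => ι).sum_comp, Fintype.sum_prod_type]
    simp only [ih, hequiv, hcons, Fin.cons_zero, Fin.cons_succ,
      Fin.prod_univ_succ, sum_mul, ite_mul, zero_mul]
    rw [sum_comm]
    conv_rhs => rw [sum_comm]
    simp [mul_comm]

/-- The trace of a product of matrices as a sum over closed paths. -/
theorem Matrix.trace_reverse_ofFn_prod {ι R : Type*} [Fintype ι] [DecidableEq ι] [CommSemiring R]
    {L : ℕ} [NeZero L] (K : Fin L → Matrix ι ι R) :
    (List.ofFn K).reverse.prod.trace = ∑ s : Fin L → ι, ∏ j, K j (s (j + 1)) (s j) := by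
  obtain ⟨n, rfl⟩ := Nat.exists_eq_succ_of_ne_zero (NeZero.ne L)
  simp only [Matrix.trace, Matrix.diag, List.reverse_ofFn_prod_apply]
  rw [Finset.sum_comm]
  refine Finset.sum_congr rfl fun s _ => ?_
  have h0 : ∀ a, (Fin.snoc s a : Fin (n + 2) → ι) 0 = s 0 := fun a => by
    rw [← Fin.castSucc_zero, Fin.snoc_castSucc]
  simp only [h0, Finset.sum_ite_eq, Finset.mem_univ, if_true]
  refine Finset.prod_congr rfl fun j _ => ?_
  congr 1
  induction j using Fin.lastCases with
  | last => simp
  | cast j => rw [Fin.succ_castSucc, Fin.snoc_castSucc, Fin.coeSucc_eq_succ]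

/-- A product of R-matrices acting on distinct sites factors through the two-dimensional
auxiliary space once the states of the chain are fixed. -/
theorem Raux_list_prod_apply (L : ℕ) (η lam : ℂ) (l : List (Fin L)) (hl : l.Nodup)
    (a b : Fin 2) (v w : Chain L) :
    (l.map (Raux L η lam)).prod (a, v) (b, w) =
      if ∀ k, k ∉ l → v k = w k then
        (l.map fun j => Matrix.of fun c d => Rmat η lam (c, v j) (d, w j)).prod a b
      else 0 := by
  induction l generalizing a v with
  | nil =>
    by_cases h : v = w
    · simp [h, Matrix.one_apply]
    · simp [h, ← funext_iff]
  | cons j l ih =>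
    obtain ⟨hj, hl⟩ := List.nodup_cons.1 hl
    rw [List.map_cons, List.prod_cons, List.map_cons, List.prod_cons, Matrix.mul_apply,
      Fintype.sum_prod_type, Matrix.mul_apply]
    have key : ∀ c : Fin 2,
        ∑ u : Chain L, Raux L η lam j (a, v) (c, u) * (l.map (Raux L η lam)).prod (c, u) (b, w) =
        if ∀ k, k ∉ j :: l → v k = w k then
          Rmat η lam (a, v j) (c, w j) *
            (l.map fun j => Matrix.of fun c d => Rmat η lam (c, v j) (d, w j)).prod c b
        else 0 := by
      intro c
      rw [Finset.sum_eq_single (Function.update v j (w j))]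
      · rw [ih hl]
        have h1 : (∀ k, k ∉ l → Function.update v j (w j) k = w k) ↔
            ∀ k, k ∉ j :: l → v k = w k := by
          refine forall_congr' fun k => ?_
          by_cases hk : k = j
          · subst hk; simp
          · simp [hk]
        have h2 : (l.map fun i => Matrix.of fun c d =>
              Rmat η lam (c, Function.update v j (w j) i) (d, w i)) =
            l.map fun i => Matrix.of fun c d => Rmat η lam (c, v i) (d, w i) := by
          refine List.map_congr_left fun i hi => ?_
          rw [Function.update_of_ne (ne_of_mem_of_not_mem hi hj)]
        have h3 : ∀ k, k ≠ j → v k = Function.update v j (w j) k := fun k hk => by simp [hk]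
        rw [if_congr h1 rfl rfl, h2]
        simp only [Raux, Matrix.of_apply, Function.update_self, if_pos h3, mul_one, mul_ite,
          mul_zero]
      · intro u _ hu
        rw [ih hl]
        simp only [Raux, Matrix.of_apply]
        split_ifs with h1 h2
        · refine absurd (funext fun k => ?_) hu
          by_cases hk : k = j
          · subst hk; simpa using h2 k hj
          · simp [hk, h1 k hk]
        all_goals simp
      · simp
    simp only [key]
    split_ifs <;> simp

theorem transfer_apply (L : ℕ) [NeZero L] (η lam : ℂ) (v w : Chain L) :
    transfer L η lam v w = ∑ s : Chain L, ∏ j, Rmat η lam (s (j + 1), v j) (s j, w j) := by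
  have h := Matrix.trace_reverse_ofFn_prod fun j : Fin L =>
    Matrix.of fun c d => Rmat η lam (c, v j) (d, w j)
  simp only [Matrix.of_apply] at h
  rw [← h, transfer, Matrix.of_apply, Matrix.trace]
  refine Finset.sum_congr rfl fun a _ => ?_
  rw [monodromy, List.ofFn_eq_map, ← List.map_reverse,
    Raux_list_prod_apply _ _ _ _ (List.nodup_reverse.2 (List.nodup_finRange L)),
    if_pos (by simp), List.ofFn_eq_map, ← List.map_reverse, Matrix.diag]

theorem Rmat_zero {η : ℂ} (hη : Complex.sinh η ≠ 0) (a b c d : Fin 2) :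
    Rmat η 0 (a, b) (c, d) = if a = d ∧ b = c then 1 else 0 := by
  fin_cases a <;> fin_cases b <;> fin_cases c <;> fin_cases d <;> simp [Rmat, hη]

/-- The derivative of the six-vertex R-matrix at zero spectral parameter. -/
noncomputable def RmatDeriv (η : ℂ) : Matrix (Fin 2 × Fin 2) (Fin 2 × Fin 2) ℂ :=
  Matrix.of fun p q =>
    if p = q then (if p.1 = p.2 then 0 else 1 / Complex.sinh η)
    else if p.1 = q.2 ∧ p.2 = q.1 ∧ p.1 ≠ p.2 then -Complex.cosh η / Complex.sinh η
    else 0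

theorem hasDerivAt_Rmat {η : ℂ} (hη : Complex.sinh η ≠ 0) (p q : Fin 2 × Fin 2) :
    HasDerivAt (fun lam => Rmat η lam p q) (RmatDeriv η p q) 0 := by
  have hs : HasDerivAt (fun lam : ℂ => Complex.sinh (lam + η)) (Complex.cosh η) 0 := by
    simpa using ((hasDerivAt_id (0 : ℂ)).add_const η).csinh
  have h0 : Complex.sinh (0 + η) ≠ 0 := by simpa using hη
  simp only [Rmat, RmatDeriv, Matrix.of_apply]
  split_ifs
  · exact hasDerivAt_const _ _
  · refine ((Complex.hasDerivAt_sinh 0).fun_div hs h0).congr_deriv ?_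
    simp
    field_simp
  · refine ((hasDerivAt_const (0 : ℂ) (Complex.sinh η)).fun_div hs h0).congr_deriv ?_
    simp
    field_simp
  · exact hasDerivAt_const _ _

theorem siteOp_mul_siteOp_apply (L : ℕ) (m m' : Matrix (Fin 2) (Fin 2) ℂ) {i j : Fin L}
    (hij : i ≠ j) (v w : Chain L) :
    (siteOp L m i * siteOp L m' j) v w =
      m (v i) (w i) * m' (v j) (w j) * if ∀ k, k ≠ i → k ≠ j → v k = w k then 1 else 0 := by
  rw [Matrix.mul_apply, Finset.sum_eq_single (Function.update v i (w i))]
  · have h1 : ∀ k, k ≠ i → v k = Function.update v i (w i) k := fun k hk => by simp [hk]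
    have h2 : (∀ k, k ≠ j → Function.update v i (w i) k = w k) ↔
        ∀ k, k ≠ i → k ≠ j → v k = w k := by
      refine forall_congr' fun k => ?_
      by_cases hk : k = i
      · subst hk; simp
      · simp [hk]
    simp only [siteOp, Matrix.of_apply, if_pos h1, if_congr h2 rfl rfl, Function.update_self,
      Function.update_of_ne hij.symm, mul_one, mul_assoc]
  · intro u _ hu
    simp only [siteOp, Matrix.of_apply]
    split_ifs with h1 h2
    · refine absurd (funext fun k => ?_) hu
      by_cases hk : k = i
      · subst hk; simpa using h2 k hij
      · simp [hk, h1 k hk]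
    all_goals simp
  · simp

/-- The local XXZ interaction is the derivative of the R-matrix, composed with the flip. -/
theorem pauli_interaction_eq {η : ℂ} (hη : Complex.sinh η ≠ 0) (a b c d : Fin 2) :
    pauli 0 a c * pauli 0 b d + pauli 1 a c * pauli 1 b d +
        Complex.cosh η * (pauli 2 a c * pauli 2 b d - if a = c ∧ b = d then 1 else 0) =
      2 * Complex.sinh η * RmatDeriv η (b, a) (c, d) := by
  fin_cases a <;> fin_cases b <;> fin_cases c <;> fin_cases d <;>
    simp [pauli, RmatDeriv] <;> field_simp <;> norm_num

theorem XXZ_bond_apply {L : ℕ} {η : ℂ} (hη : Complex.sinh η ≠ 0) {i j : Fin L}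
    (hij : i ≠ j) (v w : Chain L) :
    (siteOp L (pauli 0) i * siteOp L (pauli 0) j + siteOp L (pauli 1) i * siteOp L (pauli 1) j +
      Complex.cosh η • (siteOp L (pauli 2) i * siteOp L (pauli 2) j - 1)) v w =
    2 * Complex.sinh η * (RmatDeriv η (v j, v i) (w i, w j) *
      if ∀ k, k ≠ i → k ≠ j → v k = w k then 1 else 0) := by
  have h1 : (1 : Matrix (Chain L) (Chain L) ℂ) v w =
      (if v i = w i ∧ v j = w j then 1 else 0) *
        if ∀ k, k ≠ i → k ≠ j → v k = w k then 1 else 0 := by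
    rw [Matrix.one_apply, ite_zero_mul_ite_zero, mul_one]
    refine if_congr ⟨fun h => by simp [h], fun h => funext fun k => ?_⟩ rfl rfl
    by_cases hi : k = i
    · exact hi ▸ h.1.1
    by_cases hj : k = j
    · exact hj ▸ h.1.2
    exact h.2 k hi hj
  rw [← mul_assoc, ← pauli_interaction_eq hη]
  simp only [Matrix.add_apply, Matrix.smul_apply, Matrix.sub_apply, smul_eq_mul, h1,
    siteOp_mul_siteOp_apply L _ _ hij]
  ring

/-- The cyclic shift of the states of a chain. -/
def chainShift (L : ℕ) [NeZero L] : Chain L ≃ Chain L :=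
  (Equiv.addRight (1 : Fin L)).symm.arrowCongr (Equiv.refl _)

theorem chainShift_apply (L : ℕ) [NeZero L] (v : Chain L) (j : Fin L) :
    chainShift L v j = v (j + 1) := rfl

theorem transfer_zero (L : ℕ) [NeZero L] {η : ℂ} (hη : Complex.sinh η ≠ 0) :
    transfer L η 0 = (1 : Matrix (Chain L) (Chain L) ℂ).submatrix (chainShift L) id := by
  ext v w
  rw [transfer_apply, Finset.sum_eq_single v]
  · simp only [Rmat_zero hη, and_true, Finset.prod_ite_zero, Finset.prod_const_one,
      Matrix.submatrix_apply, Matrix.one_apply, funext_iff, chainShift_apply, Finset.mem_univ,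
      true_implies, id]
  · intro s _ hs
    obtain ⟨k, hk⟩ := Function.ne_iff.1 hs
    exact Finset.prod_eq_zero (Finset.mem_univ k) (by simp [Rmat_zero hη, hk.symm])
  · simp

theorem sum_prod_erase_Rmat_zero {L : ℕ} [NeZero L] {η : ℂ} (hη : Complex.sinh η ≠ 0)
    {j : Fin L} (hj : j ≠ j + 1) (v w : Chain L) :
    ∑ s : Chain L, (∏ k ∈ Finset.univ.erase (j + 1), Rmat η 0 (s (k + 1), v k) (s k, w k)) *
        RmatDeriv η (s (j + 1 + 1), v (j + 1)) (s (j + 1), w (j + 1)) =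
      RmatDeriv η (v (j + 1 + 1), v (j + 1)) (w j, w (j + 1)) *
        if ∀ k, k ≠ j → k ≠ j + 1 → v (k + 1) = w k then 1 else 0 := by
  have hj2 : j + 1 + 1 ≠ j + 1 := fun h => hj (add_right_cancel h).symm
  simp only [Rmat_zero hη, Finset.prod_ite_zero, Finset.prod_const_one, Finset.mem_erase,
    Finset.mem_univ, and_true]
  rw [Finset.sum_eq_single (Function.update v (j + 1) (w j))]
  · rw [Function.update_self, Function.update_of_ne hj2, mul_comm]
    congr 1
    refine if_congr ⟨fun h k hk hk' => ?_, fun h k hk => ⟨?_, ?_⟩⟩ rfl rfl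
    · have := (h k hk').1
      rwa [Function.update_of_ne (fun h => hk (add_right_cancel h))] at this
    · by_cases hkj : k = j
      · subst hkj; simp
      · rw [Function.update_of_ne (fun h => hkj (add_right_cancel h)), h k hkj hk]
    · rw [Function.update_of_ne hk]
  · intro s _ hs
    rw [if_neg, zero_mul]
    refine fun h => hs (funext fun k => ?_)
    by_cases hk : k = j + 1
    · subst hk; simpa using (h j hj).1
    · simpa [hk] using (h k hk).2.symm
  · simp

/-- The XXZ Hamiltonian is the logarithmic derivative of the transfer matrix at zero
spectral parameter: `λ ↦ T(λ)` is differentiable at `0` and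
`H₀ = 2 J sinh(η) · T(0)⁻¹ · T′(0)` (with `Δ = cosh η`). -/
theorem hamiltonian_from_transfer (L : ℕ) [NeZero L] (hL : 2 ≤ L) (J : ℝ) (hJ : J ≠ 0)
    (η : ℂ) (hη : Complex.sinh η ≠ 0) :
    ∃ T' : Matrix (Chain L) (Chain L) ℂ,
      (∀ v w : Chain L, HasDerivAt (fun lam => transfer L η lam v w) (T' v w) 0) ∧
      XXZham L J (Complex.cosh η) =
        (2 * (J : ℂ) * Complex.sinh η) • ((transfer L η 0)⁻¹ * T') := by
  have hne : ∀ j : Fin L, j ≠ j + 1 := by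
    obtain ⟨n, rfl⟩ := Nat.exists_eq_add_of_le' hL
    exact fun j h => by simp at h
  refine ⟨Matrix.of fun v w => ∑ s : Chain L, ∑ j,
    (∏ k ∈ Finset.univ.erase j, Rmat η 0 (s (k + 1), v k) (s k, w k)) *
      RmatDeriv η (s (j + 1), v j) (s j, w j), fun v w => ?_, ?_⟩
  · simp only [transfer_apply, Matrix.of_apply]
    refine HasDerivAt.fun_sum fun s _ => ?_
    simpa using HasDerivAt.fun_finsetProd (u := Finset.univ)
      fun j _ => hasDerivAt_Rmat hη (s (j + 1), v j) (s j, w j)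
  · have hT : IsUnit (transfer L η 0).det := by
      rw [transfer_zero L hη, ← Matrix.isUnit_iff_isUnit_det]
      exact (Matrix.isUnit_submatrix_equiv (chainShift L) (Equiv.refl _)).2 isUnit_one
    rw [← Matrix.mul_smul, ← Matrix.nonsing_inv_mul_cancel_left (transfer L η 0) (XXZham _ _ _) hT]
    congr 1
    rw [transfer_zero L hη]
    ext v w
    have hS : ∀ M : Matrix (Chain L) (Chain L) ℂ,
        ((1 : Matrix (Chain L) (Chain L) ℂ).submatrix (chainShift L) id * M) v w =
          M (chainShift L v) w := fun M => by
      simp [Matrix.mul_apply, Matrix.one_apply]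
    simp only [hS, XXZham, Matrix.smul_apply, Matrix.sum_apply, Matrix.of_apply,
      XXZ_bond_apply hη (hne _), chainShift_apply, smul_eq_mul]
    conv_rhs => rw [Finset.sum_comm, ← Equiv.sum_comp (Equiv.addRight (1 : Fin L))]
    simp only [Equiv.coe_addRight, sum_prod_erase_Rmat_zero hη (hne _), ← Finset.mul_sum]
    rw [mul_comm 2 (J : ℂ), mul_assoc (J : ℂ), mul_assoc (J : ℂ)]
    rfl
end
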